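/- arXiv:1304.7799 — 8 statements merged into one kernel-verified Lean document; each statement's English description precedes it below -/
import Mathlib

section
/- Let T (triple patterns) and V (join variables) be types, and let inc : T → Finset V assign to each triple pattern its finite set of join variables, with (inc t).card ≤ 2 for every t : T. Define the graph of triple patterns GoT : SimpleGraph T by: t and t' are adjacent iff t ≠ t' and (inc t ∩ inc t').Nonempty; and define the graph of join variables GoJ : SimpleGraph V by: v and v' are adjacent iff v ≠ v' and there exists t : T with v ∈ inc t and v' ∈ inc t. Then: if GoT is acyclic (SimpleGraph.IsAcyclic), GoJ is acyclic as well. -/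
theorem Finset.eq_or_eq_of_card_le_two {α : Type*} [DecidableEq α] {s : Finset α}
    (hs : s.card ≤ 2) {a b x : α} (ha : a ∈ s) (hb : b ∈ s) (hab : a ≠ b) (hx : x ∈ s) :
    x = a ∨ x = b := by
  have hpair : ({a, b} : Finset α) = s :=
    Finset.eq_of_subset_of_card_le (by grind) (by rwa [Finset.card_pair hab])
  simpa [← hpair] using hx

/-- Follow a walk of join variables that avoids the edge `ab` by a walk of triple patterns
that avoids a pattern `t₀` containing `a` and `b`, hence avoids every edge at `t₀`. -/
theorem SimpleGraph.exists_reachable_of_reachable_deleteEdges {T V : Type*} [DecidableEq V]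
    {inc : T → Finset V} (hcard : ∀ t : T, (inc t).card ≤ 2)
    {GoT : SimpleGraph T}
    (hGoT : ∀ t t' : T, GoT.Adj t t' ↔ t ≠ t' ∧ (inc t ∩ inc t').Nonempty)
    {GoJ : SimpleGraph V}
    (hGoJ : ∀ v v' : V, GoJ.Adj v v' ↔ v ≠ v' ∧ ∃ t : T, v ∈ inc t ∧ v' ∈ inc t)
    {a b : V} {t₀ t₁ : T} (ha : a ∈ inc t₀) (hb : b ∈ inc t₀) (hab : a ≠ b)
    {x y : V} (hxy : (GoJ.deleteEdges {s(a, b)}).Reachable x y)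
    {t : T} (ht : t ≠ t₀) (hx : x ∈ inc t) :
    ∃ t', t' ≠ t₀ ∧ y ∈ inc t' ∧ (GoT.deleteEdges {s(t₀, t₁)}).Reachable t t' := by
  obtain ⟨p⟩ := hxy
  induction p generalizing t with
  | nil => exact ⟨t, ht, hx, .rfl⟩
  | @cons u v w h p ih =>
    obtain ⟨hadj, he⟩ := SimpleGraph.deleteEdges_adj.1 h
    obtain ⟨huv, s, hus, hvs⟩ := (hGoJ u v).1 hadj
    have hs : s ≠ t₀ := by
      rintro rfl
      have hu := Finset.eq_or_eq_of_card_le_two (hcard s) ha hb hab hus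
      have hv := Finset.eq_or_eq_of_card_le_two (hcard s) ha hb hab hvs
      apply he
      rw [Set.mem_singleton_iff, Sym2.eq_iff]
      grind
    obtain ⟨t', ht', hwt', hreach⟩ := ih hs hvs
    refine ⟨t', ht', hwt', ?_⟩
    by_cases hts : t = s
    · rwa [hts]
    · refine SimpleGraph.Reachable.trans (SimpleGraph.Adj.reachable ?_) hreach
      refine SimpleGraph.deleteEdges_adj.2
        ⟨(hGoT t s).2 ⟨hts, u, Finset.mem_inter.2 ⟨hx, hus⟩⟩, ?_⟩
      rw [Set.mem_singleton_iff, Sym2.eq_iff]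
      grind

/-- **Lemma 2 (first direction).** If the graph of triple patterns (GoT) of a join
query is acyclic, then the graph of join variables (GoJ) is acyclic too. -/
theorem got_acyclic_implies_goj_acyclic
    {T V : Type} [DecidableEq V]
    (inc : T → Finset V)
    (hcard : ∀ t : T, (inc t).card ≤ 2)
    (GoT : SimpleGraph T)
    (hGoT : ∀ t t' : T, GoT.Adj t t' ↔ t ≠ t' ∧ (inc t ∩ inc t').Nonempty)
    (GoJ : SimpleGraph V)
    (hGoJ : ∀ v v' : V, GoJ.Adj v v' ↔ v ≠ v' ∧ ∃ t : T, v ∈ inc t ∧ v' ∈ inc t)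
    (hacyc : GoT.IsAcyclic) :
    GoJ.IsAcyclic := by
  rw [SimpleGraph.isAcyclic_iff_forall_adj_isBridge] at hacyc ⊢
  intro a b hadj
  obtain ⟨hab, t₀, ha, hb⟩ := (hGoJ a b).1 hadj
  rw [SimpleGraph.isBridge_iff]
  rintro ⟨p⟩
  cases p with
  | nil => exact hab rfl
  | @cons _ c _ h p =>
    obtain ⟨hac', he⟩ := SimpleGraph.deleteEdges_adj.1 h
    obtain ⟨hac, t₁, ha₁, hc₁⟩ := (hGoJ a c).1 hac'
    have hcb : c ≠ b := by
      rintro rfl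
      exact he rfl
    have hb₁ : b ∉ inc t₁ := fun hb₁ => by
      have := Finset.eq_or_eq_of_card_le_two (hcard t₁) ha₁ hc₁ hac hb₁
      grind
    have ht₁ : t₁ ≠ t₀ := by
      rintro rfl
      exact hb₁ hb
    obtain ⟨t', ht', hbt', hreach⟩ :=
      SimpleGraph.exists_reachable_of_reachable_deleteEdges (t₁ := t₁) hcard hGoT hGoJ
        ha hb hab ⟨p⟩ ht₁ hc₁
    have hbridge := hacyc ((hGoT t₀ t₁).2 ⟨ht₁.symm, a, Finset.mem_inter.2 ⟨ha, ha₁⟩⟩)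
    rw [SimpleGraph.isBridge_iff] at hbridge
    refine hbridge (SimpleGraph.Reachable.symm (hreach.trans (SimpleGraph.Adj.reachable ?_)))
    refine SimpleGraph.deleteEdges_adj.2
      ⟨(hGoT t' t₀).2 ⟨ht', b, Finset.mem_inter.2 ⟨hbt', hb⟩⟩, ?_⟩
    rw [Set.mem_singleton_iff, Sym2.eq_iff]
    grind
end

section
/- Let T (triple patterns) and V (join variables) be types, and let inc : T → Finset V assign to each triple pattern its finite set of join variables. Define the graph of join variables GoJ : SimpleGraph V by: v and v' are adjacent iff v ≠ v' and there exists t : T with v ∈ inc t and v' ∈ inc t. Suppose n ≥ 3 and there exist triple patterns t₁, …, tₙ and pairwise distinct join variables j₁, …, jₙ such that jᵢ ∈ inc tᵢ ∩ inc t₍ᵢ₊₁₎ for 1 ≤ i < n and jₙ ∈ inc tₙ ∩ inc t₁. Then GoJ is not acyclic: it contains the cycle j₁, j₂, …, jₙ, j₁. -/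
/-- A graph containing an injective cyclic sequence of at least three vertices, each adjacent to
the next, is not acyclic. -/
theorem SimpleGraph.not_isAcyclic_of_adj_add_one {V : Type*} {G : SimpleGraph V} {m : ℕ}
    (f : Fin (m + 3) → V) (hf : Function.Injective f) (hadj : ∀ i, G.Adj (f i) (f (i + 1))) :
    ¬ G.IsAcyclic := by
  intro h
  let φ : SimpleGraph.cycleGraph (m + 3) →g G :=
    { toFun := f
      map_rel' := by
        intro u v huv
        rcases SimpleGraph.cycleGraph_adj.mp huv with huv | huv
        · rw [sub_eq_iff_eq_add'.mp huv]
          exact (hadj v).symm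
        · rw [sub_eq_iff_eq_add'.mp huv]
          exact hadj u }
  exact h.comap φ hf _ SimpleGraph.cycleGraph.isCycle_cycle

/-- **Lemma 2 (second direction).** A cycle among the triple patterns, in which
consecutive patterns join over pairwise distinct join variables, forces a cycle
in the graph of join variables (GoJ): if `n ≥ 3` and there are triple patterns
`t 0, …, t (n-1)` and pairwise distinct join variables `j 0, …, j (n-1)` with
`j i ∈ inc (t i) ∩ inc (t (i+1))` (indices cyclically, so `j (n-1)` belongs to
both `inc (t (n-1))` and `inc (t 0)`), then GoJ is not acyclic. -/
theorem tp_cycle_implies_goj_cyclic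
    {T V : Type}
    (inc : T → Finset V)
    (GoJ : SimpleGraph V)
    (hGoJ : ∀ v v' : V, GoJ.Adj v v' ↔ v ≠ v' ∧ ∃ t : T, v ∈ inc t ∧ v' ∈ inc t)
    (n : ℕ) (hn : 3 ≤ n)
    (t : Fin n → T) (j : Fin n → V)
    (hj : Function.Injective j)
    (hmem : ∀ i : Fin n, j i ∈ inc (t i) ∧ j i ∈ inc (t (i + ⟨1, by omega⟩))) :
    ¬ GoJ.IsAcyclic := by
  obtain ⟨m, rfl⟩ := Nat.exists_eq_add_of_le' hn
  refine SimpleGraph.not_isAcyclic_of_adj_add_one j hj fun i => (hGoJ _ _).mpr ⟨?_, ?_⟩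
  · exact hj.ne (left_ne_add.mpr one_ne_zero)
  · exact ⟨t (i + 1), (hmem i).2, (hmem (i + 1)).1⟩
end

section
/- Let T₁, T₂, T₃, J be types, f : T₁ → J, g : T₂ → J, h : T₃ → J, and R₁ : Set T₁, R₂ : Set T₂, R₃ : Set T₃. Define the pruned sets R₂' = {t₂ ∈ R₂ | g t₂ ∈ f '' R₁ ∧ g t₂ ∈ h '' R₃} and R₃' = {t₃ ∈ R₃ | h t₃ ∈ f '' R₁ ∧ h t₃ ∈ g '' R₂}. Let L = {(t₁, some t₂) | t₁ ∈ R₁ ∧ t₂ ∈ R₂' ∧ f t₁ = g t₂} ∪ {(t₁, none) | t₁ ∈ R₁ ∧ ∀ t₂ ∈ R₂', f t₁ ≠ g t₂}, and let Reord be the left-outer-join of L with R₃', where (t₁, some t₂) joins t₃ ∈ R₃' iff g t₂ = h t₃, and (t₁, none) joins t₃ ∈ R₃' iff f t₁ = h t₃ (the join uses the coalesced ?j-binding). Then Reord = {((t₁, some t₂), some t₃) | t₁ ∈ R₁ ∧ t₂ ∈ R₂ ∧ t₃ ∈ R₃ ∧ f t₁ = g t₂ ∧ g t₂ = h t₃}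 ∪ {((t₁, none), none) | t₁ ∈ R₁ ∧ ¬∃ t₂ ∈ R₂, ∃ t₃ ∈ R₃, f t₁ = g t₂ ∧ g t₂ = h t₃}. In particular Reord contains no element of the form ((t₁, some t₂), none) or ((t₁, none), some t₃), so neither nullification nor best-match is required, and Reord is in canonical bijection with the original result of tp₁ OPTIONAL (tp₂ JOIN tp₃) evaluated on the unpruned R₁, R₂, R₃. -/
section

variable {T₁ T₂ T₃ J : Type}

/-- Semi-join/clustered-semi-join pruning of the slave `tp₂`:
keep `t₂ ∈ R₂` iff its `?j`-binding occurs in `R₁` and in `R₃`. -/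
def prune₂ (f : T₁ → J) (g : T₂ → J) (h : T₃ → J)
    (R₁ : Set T₁) (R₂ : Set T₂) (R₃ : Set T₃) : Set T₂ :=
  {t₂ ∈ R₂ | g t₂ ∈ f '' R₁ ∧ g t₂ ∈ h '' R₃}

/-- Semi-join/clustered-semi-join pruning of the slave `tp₃`:
keep `t₃ ∈ R₃` iff its `?j`-binding occurs in `R₁` and in `R₂`. -/
def prune₃ (f : T₁ → J) (g : T₂ → J) (h : T₃ → J)
    (R₁ : Set T₁) (R₂ : Set T₂) (R₃ : Set T₃) : Set T₃ :=
  {t₃ ∈ R₃ | h t₃ ∈ f '' R₁ ∧ h t₃ ∈ g '' R₂}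

/-- The first step `tp₁ OPTIONAL tp₂` of the reordered evaluation,
over the pruned set `R₂'`. -/
def LStep (f : T₁ → J) (g : T₂ → J) (R₁ : Set T₁) (R₂' : Set T₂) :
    Set (T₁ × Option T₂) :=
  {p | ∃ t₁ ∈ R₁, ∃ t₂ ∈ R₂', f t₁ = g t₂ ∧ p = (t₁, some t₂)} ∪
  {p | ∃ t₁ ∈ R₁, (∀ t₂ ∈ R₂', f t₁ ≠ g t₂) ∧ p = (t₁, none)}

/-- A row of `tp₁ OPTIONAL tp₂` joins `t₃` over the coalesced `?j`-binding:
`(t₁, some t₂)` joins `t₃` iff `g t₂ = h t₃`, and `(t₁, none)` joins `t₃`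
iff `f t₁ = h t₃`. -/
def Joins (f : T₁ → J) (g : T₂ → J) (h : T₃ → J)
    (p : T₁ × Option T₂) (t₃ : T₃) : Prop :=
  match p with
  | (_, some t₂) => g t₂ = h t₃
  | (t₁, none) => f t₁ = h t₃

/-- The reordered evaluation `(tp₁ OPTIONAL tp₂) OPTIONAL tp₃` on the pruned
sets: the left-outer-join of `LStep` with the pruned `R₃'`. -/
def Reord (f : T₁ → J) (g : T₂ → J) (h : T₃ → J)
    (R₁ : Set T₁) (R₂ : Set T₂) (R₃ : Set T₃) :
    Set ((T₁ × Option T₂) × Option T₃) :=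
  {q | ∃ p ∈ LStep f g R₁ (prune₂ f g h R₁ R₂ R₃),
        ∃ t₃ ∈ prune₃ f g h R₁ R₂ R₃, Joins f g h p t₃ ∧ q = (p, some t₃)} ∪
  {q | ∃ p ∈ LStep f g R₁ (prune₂ f g h R₁ R₂ R₃),
        (∀ t₃ ∈ prune₃ f g h R₁ R₂ R₃, ¬ Joins f g h p t₃) ∧ q = (p, none)}

/-- The original result of `tp₁ OPTIONAL (tp₂ JOIN tp₃)` on the unpruned sets. -/
def Orig (f : T₁ → J) (g : T₂ → J) (h : T₃ → J)
    (R₁ : Set T₁) (R₂ : Set T₂) (R₃ : Set T₃) : Set (T₁ × Option (T₂ × T₃)) :=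
  {p | ∃ t₁ ∈ R₁, ∃ t₂ ∈ R₂, ∃ t₃ ∈ R₃,
        f t₁ = g t₂ ∧ g t₂ = h t₃ ∧ p = (t₁, some (t₂, t₃))} ∪
  {p | ∃ t₁ ∈ R₁, (¬ ∃ t₂ ∈ R₂, ∃ t₃ ∈ R₃, f t₁ = g t₂ ∧ g t₂ = h t₃) ∧
        p = (t₁, none)}

/-- The canonical reassociation map sending `(t₁, some (t₂, t₃))` to
`((t₁, some t₂), some t₃)` and `(t₁, none)` to `((t₁, none), none)`. -/
def reassoc : T₁ × Option (T₂ × T₃) → (T₁ × Option T₂) × Option T₃ :=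
  fun p =>
    match p with
    | (t₁, some (t₂, t₃)) => ((t₁, some t₂), some t₃)
    | (t₁, none) => ((t₁, none), none)

theorem reord_eq (f : T₁ → J) (g : T₂ → J) (h : T₃ → J)
    (R₁ : Set T₁) (R₂ : Set T₂) (R₃ : Set T₃) :
    Reord f g h R₁ R₂ R₃ =
      {q | ∃ t₁ ∈ R₁, ∃ t₂ ∈ R₂, ∃ t₃ ∈ R₃,
            f t₁ = g t₂ ∧ g t₂ = h t₃ ∧ q = ((t₁, some t₂), some t₃)} ∪
       {q | ∃ t₁ ∈ R₁, (¬ ∃ t₂ ∈ R₂, ∃ t₃ ∈ R₃, f t₁ = g t₂ ∧ g t₂ = h t₃) ∧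
            q = ((t₁, none), none)} := by
  ext q
  constructor
  · rintro (⟨p, ⟨t₁, h₁, t₂, h₂, e, rfl⟩ | ⟨t₁, h₁, hn, rfl⟩, t₃, h₃, hj, rfl⟩ |
      ⟨p, ⟨t₁, h₁, t₂, h₂, e, rfl⟩ | ⟨t₁, h₁, hn, rfl⟩, hj, rfl⟩)
    · exact Or.inl ⟨t₁, h₁, t₂, h₂.1, t₃, h₃.1, e, hj, rfl⟩
    · obtain ⟨h₃, -, t₂, h₂, e⟩ := h₃
      have hj : f t₁ = h t₃ := hj
      exact (hn t₂ ⟨h₂, ⟨t₁, h₁, hj.trans e.symm⟩, t₃, h₃, e.symm⟩ (hj.trans e.symm)).elim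
    · obtain ⟨h₂, -, t₃, h₃, e'⟩ := h₂
      exact (hj t₃ ⟨h₃, ⟨t₁, h₁, e.trans e'.symm⟩, t₂, h₂, e'.symm⟩ e'.symm).elim
    · refine Or.inr ⟨t₁, h₁, ?_, rfl⟩
      rintro ⟨t₂, h₂, t₃, h₃, e, e'⟩
      exact hn t₂ ⟨h₂, ⟨t₁, h₁, e⟩, t₃, h₃, e'.symm⟩ e
  · rintro (⟨t₁, h₁, t₂, h₂, t₃, h₃, e, e', rfl⟩ | ⟨t₁, h₁, hn, rfl⟩)
    · exact Or.inl ⟨_, Or.inl ⟨t₁, h₁, t₂, ⟨h₂, ⟨t₁, h₁, e⟩, t₃, h₃, e'.symm⟩, e, rfl⟩,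
        t₃, ⟨h₃, ⟨t₁, h₁, e.trans e'⟩, t₂, h₂, e'⟩, e', rfl⟩
    · refine Or.inr ⟨_, Or.inr ⟨t₁, h₁, ?_, rfl⟩, ?_, rfl⟩
      · rintro t₂ ⟨h₂, -, t₃, h₃, e'⟩ e
        exact hn ⟨t₂, h₂, t₃, h₃, e, e'.symm⟩
      · rintro t₃ ⟨h₃, -, t₂, h₂, e'⟩ e
        exact hn ⟨t₂, h₂, t₃, h₃, Eq.trans e e'.symm, e'⟩

theorem reassoc_injective :
    Function.Injective (reassoc : T₁ × Option (T₂ × T₃) → (T₁ × Option T₂) × Option T₃) := by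
  rintro ⟨t₁, _ | ⟨t₂, t₃⟩⟩ ⟨s₁, _ | ⟨s₂, s₃⟩⟩ e <;> simp_all [reassoc]

theorem reassoc_image_orig (f : T₁ → J) (g : T₂ → J) (h : T₃ → J)
    (R₁ : Set T₁) (R₂ : Set T₂) (R₃ : Set T₃) :
    reassoc '' Orig f g h R₁ R₂ R₃ = Reord f g h R₁ R₂ R₃ := by
  rw [reord_eq]
  ext q
  constructor
  · rintro ⟨p, ⟨t₁, h₁, t₂, h₂, t₃, h₃, e, e', rfl⟩ | ⟨t₁, h₁, hn, rfl⟩, rfl⟩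
    · exact Or.inl ⟨t₁, h₁, t₂, h₂, t₃, h₃, e, e', rfl⟩
    · exact Or.inr ⟨t₁, h₁, hn, rfl⟩
  · rintro (⟨t₁, h₁, t₂, h₂, t₃, h₃, e, e', rfl⟩ | ⟨t₁, h₁, hn, rfl⟩)
    · exact ⟨_, Or.inl ⟨t₁, h₁, t₂, h₂, t₃, h₃, e, e', rfl⟩, rfl⟩
    · exact ⟨_, Or.inr ⟨t₁, h₁, hn, rfl⟩, rfl⟩

/-- **Key case in the proof of Lemma 4.** For
`tp₁ OPTIONAL_{?j} (tp₂ JOIN_{?j} tp₃)` with a single shared join variable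
`?j`, after semi-join and clustered-semi-join pruning the reordered evaluation
`(tp₁ OPTIONAL tp₂) OPTIONAL tp₃` equals the expected set of rows: there are
no rows of the form `((t₁, some t₂), none)` or `((t₁, none), some t₃)` (so
neither nullification nor best-match is required), and it is in canonical
bijection with the original result on the unpruned sets. -/
theorem pruned_reorder_single_jvar
    (f : T₁ → J) (g : T₂ → J) (h : T₃ → J)
    (R₁ : Set T₁) (R₂ : Set T₂) (R₃ : Set T₃) :
    Reord f g h R₁ R₂ R₃ =
      ({q | ∃ t₁ ∈ R₁, ∃ t₂ ∈ R₂, ∃ t₃ ∈ R₃,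
            f t₁ = g t₂ ∧ g t₂ = h t₃ ∧ q = ((t₁, some t₂), some t₃)} ∪
       {q | ∃ t₁ ∈ R₁, (¬ ∃ t₂ ∈ R₂, ∃ t₃ ∈ R₃, f t₁ = g t₂ ∧ g t₂ = h t₃) ∧
            q = ((t₁, none), none)}) ∧
    (∀ q ∈ Reord f g h R₁ R₂ R₃,
      ¬ ∃ (t₁ : T₁) (t₂ : T₂), q = ((t₁, some t₂), (none : Option T₃))) ∧
    (∀ q ∈ Reord f g h R₁ R₂ R₃,
      ¬ ∃ (t₁ : T₁) (t₃ : T₃), q = ((t₁, (none : Option T₂)), some t₃)) ∧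
    Set.BijOn reassoc (Orig f g h R₁ R₂ R₃) (Reord f g h R₁ R₂ R₃) := by
  refine ⟨reord_eq f g h R₁ R₂ R₃, ?_, ?_, ?_⟩
  · rw [reord_eq]
    rintro q (⟨_, _, _, _, _, _, _, _, rfl⟩ | ⟨_, _, _, rfl⟩) ⟨_, _, e⟩ <;> simp at e
  · rw [reord_eq]
    rintro q (⟨_, _, _, _, _, _, _, _, rfl⟩ | ⟨_, _, _, rfl⟩) ⟨_, _, e⟩ <;> simp at e
  · rw [← reassoc_image_orig]
    exact reassoc_injective.injOn.bijOn_image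

end
end

section
/- Let T₁, T₂, J be types, f : T₁ → J, g : T₂ → J, R₁ : Set T₁, R₂ : Set T₂, and define the semi-join R₂ ⋉ R₁ = {t₂ ∈ R₂ | g t₂ ∈ f '' R₁}. Then: (a) the inner join is unchanged: {(t₁, t₂) | t₁ ∈ R₁ ∧ t₂ ∈ R₂ ⋉ R₁ ∧ f t₁ = g t₂} = {(t₁, t₂) | t₁ ∈ R₁ ∧ t₂ ∈ R₂ ∧ f t₁ = g t₂}; and (b) the left-outer-join is unchanged: ({(t₁, some t₂) | t₁ ∈ R₁ ∧ t₂ ∈ R₂ ⋉ R₁ ∧ f t₁ = g t₂} ∪ {(t₁, none) | t₁ ∈ R₁ ∧ ∀ t₂ ∈ R₂ ⋉ R₁, f t₁ ≠ g t₂}) = ({(t₁, some t₂) | t₁ ∈ R₁ ∧ t₂ ∈ R₂ ∧ f t₁ = g t₂} ∪ {(t₁, none) | t₁ ∈ R₁ ∧ ∀ t₂ ∈ R₂, f t₁ ≠ g t₂}). -/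
section

variable {T₁ T₂ J : Type}

/-- The semi-join `R₂ ⋉ R₁`: the triples of the slave `R₂` whose `?j`-binding
also occurs among the `?j`-bindings of the master `R₁`. -/
def SemiJoin (f : T₁ → J) (g : T₂ → J) (R₁ : Set T₁) (R₂ : Set T₂) : Set T₂ :=
  {t₂ ∈ R₂ | g t₂ ∈ f '' R₁}

/-- The inner join of `R₁` and `R₂` over `?j`. -/
def InnerJoin (f : T₁ → J) (g : T₂ → J) (R₁ : Set T₁) (R₂ : Set T₂) :
    Set (T₁ × T₂) :=
  {p | p.1 ∈ R₁ ∧ p.2 ∈ R₂ ∧ f p.1 = g p.2}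

/-- The left-outer-join `R₁ ⟕ R₂` over `?j`: all matched pairs
`(t₁, some t₂)` with `f t₁ = g t₂`, together with `(t₁, none)` for every
`t₁ ∈ R₁` matching no triple of `R₂`. -/
def LeftOuterJoin (f : T₁ → J) (g : T₂ → J) (R₁ : Set T₁) (R₂ : Set T₂) :
    Set (T₁ × Option T₂) :=
  {p | ∃ t₁ ∈ R₁, ∃ t₂ ∈ R₂, f t₁ = g t₂ ∧ p = (t₁, some t₂)} ∪
  {p | ∃ t₁ ∈ R₁, (∀ t₂ ∈ R₂, f t₁ ≠ g t₂) ∧ p = (t₁, none)}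

theorem mem_semiJoin_iff {f : T₁ → J} {g : T₂ → J} {R₁ : Set T₁} {R₂ : Set T₂}
    {t₁ : T₁} {t₂ : T₂} (h₁ : t₁ ∈ R₁) (h : f t₁ = g t₂) :
    t₂ ∈ SemiJoin f g R₁ R₂ ↔ t₂ ∈ R₂ :=
  ⟨And.left, fun h₂ => ⟨h₂, t₁, h₁, h⟩⟩

/-- Semi-joins transfer the restrictions on variable bindings from a master
triple pattern to a slave without actually performing the join:
(a) the inner join is unchanged, and (b) the left-outer-join is unchanged,
when the slave `R₂` is replaced by the semi-join `R₂ ⋉ R₁`. -/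
theorem semi_join_preserves_joins
    (f : T₁ → J) (g : T₂ → J) (R₁ : Set T₁) (R₂ : Set T₂) :
    InnerJoin f g R₁ (SemiJoin f g R₁ R₂) = InnerJoin f g R₁ R₂ ∧
    LeftOuterJoin f g R₁ (SemiJoin f g R₁ R₂) = LeftOuterJoin f g R₁ R₂ := by
  constructor
  · ext ⟨t₁, t₂⟩
    exact and_congr_right fun h₁ => and_congr_left fun h => mem_semiJoin_iff h₁ h
  · ext p
    refine or_congr (exists_congr fun t₁ => and_congr_right fun h₁ => ?_)
      (exists_congr fun t₁ => and_congr_right fun h₁ => and_congr_left fun _ => ?_)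
    · exact exists_congr fun t₂ => and_congr_left fun h => mem_semiJoin_iff h₁ h.1
    · exact ⟨fun hn t₂ h₂ h => hn t₂ ((mem_semiJoin_iff h₁ h).2 h₂) h,
        fun hn t₂ h₂ => hn t₂ h₂.1⟩

end
end

section
/- Let T₁, T₂, T₃, J₁, J₂ be types, f : T₁ → J₁, g : T₂ → J₁, h : T₂ → J₂, k : T₃ → J₂, and R₁ : Set T₁, R₂ : Set T₂, R₃ : Set T₃. Define the minimal sets R₁* = {t₁ ∈ R₁ | ∃ t₂ ∈ R₂, ∃ t₃ ∈ R₃, f t₁ = g t₂ ∧ h t₂ = k t₃}, R₂* = {t₂ ∈ R₂ | ∃ t₁ ∈ R₁, ∃ t₃ ∈ R₃, f t₁ = g t₂ ∧ h t₂ = k t₃}, R₃* = {t₃ ∈ R₃ | ∃ t₁ ∈ R₁, ∃ t₂ ∈ R₂, f t₁ = g t₂ ∧ h t₂ = k t₃}. Perform the bottom-up pass: 𝒥₂ = h '' R₂ ∩ k '' R₃, R₂¹ = {t₂ ∈ R₂ | h t₂ ∈ 𝒥₂}, R₃¹ = {t₃ ∈ R₃ | k t₃ ∈ 𝒥₂};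 then 𝒥₁ = f '' R₁ ∩ g '' R₂¹, R₁¹ = {t₁ ∈ R₁ | f t₁ ∈ 𝒥₁}, R₂² = {t₂ ∈ R₂¹ | g t₂ ∈ 𝒥₁}; and the top-down step at ?j₂: 𝒥₂' = h '' R₂² ∩ k '' R₃¹, R₂³ = {t₂ ∈ R₂² | h t₂ ∈ 𝒥₂'}, R₃² = {t₃ ∈ R₃¹ | k t₃ ∈ 𝒥₂'}. Then R₁¹ = R₁*, R₂³ = R₂² = R₂*, and R₃² = R₃*: the passes leave every triple pattern with exactly its minimal set of triples. -/
section

variable {T₁ T₂ T₃ J₁ J₂ : Type}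

/-! Three triple patterns forming a chain: `tp₁` and `tp₂` share `?j₁`
(bindings `f`, `g`), `tp₂` and `tp₃` share `?j₂` (bindings `h`, `k`). -/

/-- Minimal set of triples for `tp₁`. -/
def R₁star (f : T₁ → J₁) (g : T₂ → J₁) (h : T₂ → J₂) (k : T₃ → J₂)
    (R₁ : Set T₁) (R₂ : Set T₂) (R₃ : Set T₃) : Set T₁ :=
  {t₁ ∈ R₁ | ∃ t₂ ∈ R₂, ∃ t₃ ∈ R₃, f t₁ = g t₂ ∧ h t₂ = k t₃}

/-- Minimal set of triples for `tp₂`. -/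
def R₂star (f : T₁ → J₁) (g : T₂ → J₁) (h : T₂ → J₂) (k : T₃ → J₂)
    (R₁ : Set T₁) (R₂ : Set T₂) (R₃ : Set T₃) : Set T₂ :=
  {t₂ ∈ R₂ | ∃ t₁ ∈ R₁, ∃ t₃ ∈ R₃, f t₁ = g t₂ ∧ h t₂ = k t₃}

/-- Minimal set of triples for `tp₃`. -/
def R₃star (f : T₁ → J₁) (g : T₂ → J₁) (h : T₂ → J₂) (k : T₃ → J₂)
    (R₁ : Set T₁) (R₂ : Set T₂) (R₃ : Set T₃) : Set T₃ :=
  {t₃ ∈ R₃ | ∃ t₁ ∈ R₁, ∃ t₂ ∈ R₂, f t₁ = g t₂ ∧ h t₂ = k t₃}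

/-- Bottom-up pass, clustered-semi-join at `?j₂`: the intersection `𝒥₂`. -/
def J₂bu (h : T₂ → J₂) (k : T₃ → J₂) (R₂ : Set T₂) (R₃ : Set T₃) : Set J₂ :=
  h '' R₂ ∩ k '' R₃

/-- Bottom-up pass: `R₂¹`, the triples of `R₂` retained at `?j₂`. -/
def R₂1 (h : T₂ → J₂) (k : T₃ → J₂) (R₂ : Set T₂) (R₃ : Set T₃) : Set T₂ :=
  {t₂ ∈ R₂ | h t₂ ∈ J₂bu h k R₂ R₃}

/-- Bottom-up pass: `R₃¹`, the triples of `R₃` retained at `?j₂`. -/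
def R₃1 (h : T₂ → J₂) (k : T₃ → J₂) (R₂ : Set T₂) (R₃ : Set T₃) : Set T₃ :=
  {t₃ ∈ R₃ | k t₃ ∈ J₂bu h k R₂ R₃}

/-- Bottom-up pass, clustered-semi-join at `?j₁`: the intersection `𝒥₁`. -/
def J₁bu (f : T₁ → J₁) (g : T₂ → J₁) (h : T₂ → J₂) (k : T₃ → J₂)
    (R₁ : Set T₁) (R₂ : Set T₂) (R₃ : Set T₃) : Set J₁ :=
  f '' R₁ ∩ g '' (R₂1 h k R₂ R₃)

/-- Bottom-up pass: `R₁¹`, the triples of `R₁` retained at `?j₁`. -/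
def R₁1 (f : T₁ → J₁) (g : T₂ → J₁) (h : T₂ → J₂) (k : T₃ → J₂)
    (R₁ : Set T₁) (R₂ : Set T₂) (R₃ : Set T₃) : Set T₁ :=
  {t₁ ∈ R₁ | f t₁ ∈ J₁bu f g h k R₁ R₂ R₃}

/-- Bottom-up pass: `R₂²`, the triples of `R₂¹` retained at `?j₁`. -/
def R₂2 (f : T₁ → J₁) (g : T₂ → J₁) (h : T₂ → J₂) (k : T₃ → J₂)
    (R₁ : Set T₁) (R₂ : Set T₂) (R₃ : Set T₃) : Set T₂ :=
  {t₂ ∈ R₂1 h k R₂ R₃ | g t₂ ∈ J₁bu f g h k R₁ R₂ R₃}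

/-- Top-down step, clustered-semi-join at `?j₂`: the intersection `𝒥₂'`. -/
def J₂td (f : T₁ → J₁) (g : T₂ → J₁) (h : T₂ → J₂) (k : T₃ → J₂)
    (R₁ : Set T₁) (R₂ : Set T₂) (R₃ : Set T₃) : Set J₂ :=
  h '' (R₂2 f g h k R₁ R₂ R₃) ∩ k '' (R₃1 h k R₂ R₃)

/-- Top-down step: `R₂³`, the triples of `R₂²` retained at `?j₂`. -/
def R₂3 (f : T₁ → J₁) (g : T₂ → J₁) (h : T₂ → J₂) (k : T₃ → J₂)
    (R₁ : Set T₁) (R₂ : Set T₂) (R₃ : Set T₃) : Set T₂ :=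
  {t₂ ∈ R₂2 f g h k R₁ R₂ R₃ | h t₂ ∈ J₂td f g h k R₁ R₂ R₃}

/-- Top-down step: `R₃²`, the triples of `R₃¹` retained at `?j₂`. -/
def R₃2 (f : T₁ → J₁) (g : T₂ → J₁) (h : T₂ → J₂) (k : T₃ → J₂)
    (R₁ : Set T₁) (R₂ : Set T₂) (R₃ : Set T₃) : Set T₃ :=
  {t₃ ∈ R₃1 h k R₂ R₃ | k t₃ ∈ J₂td f g h k R₁ R₂ R₃}

theorem R₂2_eq_R₂star (f : T₁ → J₁) (g : T₂ → J₁) (h : T₂ → J₂) (k : T₃ → J₂)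
    (R₁ : Set T₁) (R₂ : Set T₂) (R₃ : Set T₃) :
    R₂2 f g h k R₁ R₂ R₃ = R₂star f g h k R₁ R₂ R₃ := by
  ext t₂
  constructor
  · rintro ⟨⟨h₂, -, t₃, h₃, e₂⟩, ⟨t₁, h₁, e₁⟩, -⟩
    exact ⟨h₂, t₁, h₁, t₃, h₃, e₁, e₂.symm⟩
  · rintro ⟨h₂, t₁, h₁, t₃, h₃, e₁, e₂⟩
    have h₂' : t₂ ∈ R₂1 h k R₂ R₃ := ⟨h₂, ⟨t₂, h₂, rfl⟩, t₃, h₃, e₂.symm⟩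
    exact ⟨h₂', ⟨t₁, h₁, e₁⟩, t₂, h₂', rfl⟩

theorem R₁1_eq_R₁star (f : T₁ → J₁) (g : T₂ → J₁) (h : T₂ → J₂) (k : T₃ → J₂)
    (R₁ : Set T₁) (R₂ : Set T₂) (R₃ : Set T₃) :
    R₁1 f g h k R₁ R₂ R₃ = R₁star f g h k R₁ R₂ R₃ := by
  ext t₁
  constructor
  · rintro ⟨h₁, -, t₂, ⟨h₂, -, t₃, h₃, e₂⟩, e₁⟩
    exact ⟨h₁, t₂, h₂, t₃, h₃, e₁.symm, e₂.symm⟩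
  · rintro ⟨h₁, t₂, h₂, t₃, h₃, e₁, e₂⟩
    exact ⟨h₁, ⟨t₁, h₁, rfl⟩, t₂, ⟨h₂, ⟨t₂, h₂, rfl⟩, t₃, h₃, e₂.symm⟩, e₁.symm⟩

theorem R₂3_eq_R₂2 (f : T₁ → J₁) (g : T₂ → J₁) (h : T₂ → J₂) (k : T₃ → J₂)
    (R₁ : Set T₁) (R₂ : Set T₂) (R₃ : Set T₃) :
    R₂3 f g h k R₁ R₂ R₃ = R₂2 f g h k R₁ R₂ R₃ := by
  refine Set.Subset.antisymm (fun _ ht => ht.1) fun t₂ ht => ⟨ht, ⟨t₂, ht, rfl⟩, ?_⟩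
  obtain ⟨⟨h₂, -, t₃, h₃, e⟩, -⟩ := ht
  exact ⟨t₃, ⟨h₃, ⟨t₂, h₂, e.symm⟩, t₃, h₃, rfl⟩, e⟩

theorem R₃2_eq_R₃star (f : T₁ → J₁) (g : T₂ → J₁) (h : T₂ → J₂) (k : T₃ → J₂)
    (R₁ : Set T₁) (R₂ : Set T₂) (R₃ : Set T₃) :
    R₃2 f g h k R₁ R₂ R₃ = R₃star f g h k R₁ R₂ R₃ := by
  ext t₃
  simp only [R₃2, J₂td, R₂2_eq_R₂star]
  constructor
  · rintro ⟨⟨h₃, -⟩, ⟨t₂, ⟨h₂, t₁, h₁, -, -, e₁, -⟩, e₂⟩, -⟩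
    exact ⟨h₃, t₁, h₁, t₂, h₂, e₁, e₂⟩
  · rintro ⟨h₃, t₁, h₁, t₂, h₂, e₁, e₂⟩
    have h₃' : t₃ ∈ R₃1 h k R₂ R₃ := ⟨h₃, ⟨t₂, h₂, e₂⟩, t₃, h₃, rfl⟩
    exact ⟨h₃', ⟨t₂, ⟨h₂, t₁, h₁, t₃, h₃, e₁, e₂⟩, e₂⟩, t₃, h₃', rfl⟩

/-- **Property 1 on the path `?j₁–?j₂` (used in the proof of Lemma 3).**
For the chain `tp₁ –?j₁– tp₂ –?j₂– tp₃`, the bottom-up pass of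
clustered-semi-joins (at `?j₂`, then at `?j₁`) followed by the top-down step
at `?j₂` leaves every triple pattern with exactly its minimal set of triples:
`R₁¹ = R₁*`, `R₂³ = R₂² = R₂*`, and `R₃² = R₃*`. -/
theorem chain_passes_reach_minimality
    (f : T₁ → J₁) (g : T₂ → J₁) (h : T₂ → J₂) (k : T₃ → J₂)
    (R₁ : Set T₁) (R₂ : Set T₂) (R₃ : Set T₃) :
    R₁1 f g h k R₁ R₂ R₃ = R₁star f g h k R₁ R₂ R₃ ∧
    R₂3 f g h k R₁ R₂ R₃ = R₂2 f g h k R₁ R₂ R₃ ∧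
    R₂2 f g h k R₁ R₂ R₃ = R₂star f g h k R₁ R₂ R₃ ∧
    R₃2 f g h k R₁ R₂ R₃ = R₃star f g h k R₁ R₂ R₃ :=
  ⟨R₁1_eq_R₁star f g h k R₁ R₂ R₃, R₂3_eq_R₂2 f g h k R₁ R₂ R₃,
    R₂2_eq_R₂star f g h k R₁ R₂ R₃, R₃2_eq_R₃star f g h k R₁ R₂ R₃⟩

end
end

section
/- Fix types V and D, and let Ω₁, Ω₂, Ω₃ : Set (V → Option D) be sets of SPARQL mappings. Every spurious result of the rewrite is strictly subsumed by a genuine result: for every r ∈ (Ω₁ ⟕ Ω₂) ∪ (Ω₁ ⟕ Ω₃) with r ∉ Ω₁ ⟕ (Ω₂ ∪ Ω₃), we have r ∈ Ω₁, and there exists r' ∈ Ω₁ ⟕ (Ω₂ ∪ Ω₃) such that dom r ⊊ dom r' and r v = r' v for all v ∈ dom r. -/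
section

variable {V D : Type}

/-- The domain of a SPARQL mapping: the variables it binds. -/
def dom (μ : V → Option D) : Set V := {v | μ v ≠ none}

/-- Two mappings are compatible if they agree on the intersection of their
domains. -/
def Compatible (μ ν : V → Option D) : Prop :=
  ∀ v ∈ dom μ ∩ dom ν, μ v = ν v

/-- The union `μ ⊔ ν` of two mappings: `(μ ⊔ ν) v = μ v` if `μ v ≠ none`,
and `ν v` otherwise. -/
def mUnion (μ ν : V → Option D) : V → Option D := fun v =>
  match μ v with
  | some d => some d
  | none => ν v

/-- The SPARQL join `Ω₁ ⋈ Ω₂` of two sets of mappings. -/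
def JoinSet (Ω₁ Ω₂ : Set (V → Option D)) : Set (V → Option D) :=
  {ω | ∃ μ ∈ Ω₁, ∃ ν ∈ Ω₂, Compatible μ ν ∧ ω = mUnion μ ν}

/-- The SPARQL difference `Ω₁ ∖ Ω₂`: the mappings of `Ω₁` compatible with no
mapping of `Ω₂`. -/
def DiffSet (Ω₁ Ω₂ : Set (V → Option D)) : Set (V → Option D) :=
  {μ ∈ Ω₁ | ∀ ν ∈ Ω₂, ¬ Compatible μ ν}

/-- The SPARQL left-outer-join `Ω₁ ⟕ Ω₂ = (Ω₁ ⋈ Ω₂) ∪ (Ω₁ ∖ Ω₂)`. -/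
def LojSet (Ω₁ Ω₂ : Set (V → Option D)) : Set (V → Option D) :=
  JoinSet Ω₁ Ω₂ ∪ DiffSet Ω₁ Ω₂

theorem mUnion_apply_of_mem_dom {μ : V → Option D} (ν : V → Option D)
    {v : V} (hv : v ∈ dom μ) : mUnion μ ν v = μ v := by
  obtain ⟨d, hd⟩ := Option.ne_none_iff_exists'.mp hv
  simp [mUnion, hd]

theorem dom_subset_dom_mUnion (μ ν : V → Option D) :
    dom μ ⊆ dom (mUnion μ ν) := fun v hv => by
  change mUnion μ ν v ≠ none
  rw [mUnion_apply_of_mem_dom ν hv]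
  exact hv

theorem mUnion_eq_self_of_dom_subset {μ ν : V → Option D}
    (h : dom (mUnion μ ν) ⊆ dom μ) : mUnion μ ν = μ := by
  funext v
  by_cases hv : v ∈ dom μ
  · exact mUnion_apply_of_mem_dom ν hv
  · rw [not_not.mp hv]
    exact not_not.mp fun hne => hv (h hne)

/-- A mapping of `Ω₁` that is not a result of `Ω₁ ⟕ Ω` is strictly subsumed by one. -/
theorem exists_lojSet_dom_ssubset {Ω₁ Ω : Set (V → Option D)}
    {r : V → Option D} (hr : r ∈ Ω₁) (hr' : r ∉ LojSet Ω₁ Ω) :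
    ∃ r' ∈ LojSet Ω₁ Ω, dom r ⊂ dom r' ∧ ∀ v ∈ dom r, r v = r' v := by
  obtain ⟨ν, hν, hc⟩ : ∃ ν ∈ Ω, Compatible r ν := by
    by_contra! h
    exact hr' (Or.inr ⟨hr, h⟩)
  have hmem : mUnion r ν ∈ LojSet Ω₁ Ω := Or.inl ⟨r, hr, ν, hν, hc, rfl⟩
  refine ⟨mUnion r ν, hmem, ⟨dom_subset_dom_mUnion r ν, fun h => hr' ?_⟩,
    fun v hv => (mUnion_apply_of_mem_dom ν hv).symm⟩
  rwa [mUnion_eq_self_of_dom_subset h] at hmem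

theorem mem_of_mem_lojSet_of_notMem {Ω₁ Ω Ω' : Set (V → Option D)}
    (hΩ : Ω ⊆ Ω') {r : V → Option D} (hr : r ∈ LojSet Ω₁ Ω)
    (hr' : r ∉ LojSet Ω₁ Ω') : r ∈ Ω₁ := by
  rcases hr with ⟨μ, hμ, ν, hν, h⟩ | h
  · exact absurd (Or.inl ⟨μ, hμ, ν, hΩ hν, h⟩) hr'
  · exact h.1

/-- **Spurious results of the UNION rewrite are subsumed.** Every result of
`(Ω₁ ⟕ Ω₂) ∪ (Ω₁ ⟕ Ω₃)` that is not a result of `Ω₁ ⟕ (Ω₂ ∪ Ω₃)` belongs to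
`Ω₁` and is strictly subsumed by a genuine result: some
`r' ∈ Ω₁ ⟕ (Ω₂ ∪ Ω₃)` has strictly larger domain and agrees with `r` on
`dom r`. -/
theorem spurious_results_subsumed
    (Ω₁ Ω₂ Ω₃ : Set (V → Option D))
    (r : V → Option D)
    (hr : r ∈ LojSet Ω₁ Ω₂ ∪ LojSet Ω₁ Ω₃)
    (hr' : r ∉ LojSet Ω₁ (Ω₂ ∪ Ω₃)) :
    r ∈ Ω₁ ∧
    ∃ r' ∈ LojSet Ω₁ (Ω₂ ∪ Ω₃),
      dom r ⊂ dom r' ∧ ∀ v ∈ dom r, r v = r' v := by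
  have hmem : r ∈ Ω₁ := hr.elim
    (fun h => mem_of_mem_lojSet_of_notMem Set.subset_union_left h hr')
    (fun h => mem_of_mem_lojSet_of_notMem Set.subset_union_right h hr')
  exact ⟨hmem, exists_lojSet_dom_ssubset hmem hr'⟩

end
end

section
/- Fix types V and D, and let Ω₁, Ω₂, Ω₃ : Set (V → Option D) be sets of SPARQL mappings. The SPARQL join on sets of mappings is commutative and associative: Ω₁ ⋈ Ω₂ = Ω₂ ⋈ Ω₁ and (Ω₁ ⋈ Ω₂) ⋈ Ω₃ = Ω₁ ⋈ (Ω₂ ⋈ Ω₃). -/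
section

variable {V D : Type}

theorem Compatible.symm {μ ν : V → Option D} (h : Compatible μ ν) : Compatible ν μ :=
  fun v hv => (h v hv.symm).symm

theorem mUnion_comm {μ ν : V → Option D} (h : Compatible μ ν) : mUnion μ ν = mUnion ν μ := by
  funext v
  have hv := h v
  simp only [dom, Set.mem_inter_iff, Set.mem_ofPred_eq] at hv
  unfold mUnion
  cases hμ : μ v <;> cases hν : ν v <;> simp_all

theorem mUnion_assoc (μ ν ρ : V → Option D) :
    mUnion (mUnion μ ν) ρ = mUnion μ (mUnion ν ρ) := by
  funext v
  unfold mUnion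
  cases μ v <;> rfl

theorem compatible_mUnion_assoc (μ ν ρ : V → Option D) :
    Compatible μ ν ∧ Compatible (mUnion μ ν) ρ ↔
      Compatible ν ρ ∧ Compatible μ (mUnion ν ρ) := by
  simp only [Compatible, ← forall_and]
  refine forall_congr' fun v => ?_
  simp only [dom, Set.mem_inter_iff, Set.mem_ofPred_eq, mUnion]
  cases μ v <;> cases ν v <;> cases ρ v <;> grind

theorem joinSet_comm (Ω₁ Ω₂ : Set (V → Option D)) : JoinSet Ω₁ Ω₂ = JoinSet Ω₂ Ω₁ := by
  ext ω
  constructor <;>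
  · rintro ⟨μ, hμ, ν, hν, h, rfl⟩
    exact ⟨ν, hν, μ, hμ, h.symm, mUnion_comm h⟩

theorem joinSet_assoc (Ω₁ Ω₂ Ω₃ : Set (V → Option D)) :
    JoinSet (JoinSet Ω₁ Ω₂) Ω₃ = JoinSet Ω₁ (JoinSet Ω₂ Ω₃) := by
  ext ω
  constructor
  · rintro ⟨_, ⟨μ, hμ, ν, hν, hμν, rfl⟩, ρ, hρ, h, rfl⟩
    obtain ⟨hνρ, h'⟩ := (compatible_mUnion_assoc μ ν ρ).1 ⟨hμν, h⟩
    exact ⟨μ, hμ, _, ⟨ν, hν, ρ, hρ, hνρ, rfl⟩, h', mUnion_assoc μ ν ρ⟩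
  · rintro ⟨μ, hμ, _, ⟨ν, hν, ρ, hρ, hνρ, rfl⟩, h, rfl⟩
    obtain ⟨hμν, h'⟩ := (compatible_mUnion_assoc μ ν ρ).2 ⟨hνρ, h⟩
    exact ⟨_, ⟨μ, hμ, ν, hν, hμν, rfl⟩, ρ, hρ, h', (mUnion_assoc μ ν ρ).symm⟩

/-- **SPARQL join is commutative and associative** on sets of mappings:
`Ω₁ ⋈ Ω₂ = Ω₂ ⋈ Ω₁` and `(Ω₁ ⋈ Ω₂) ⋈ Ω₃ = Ω₁ ⋈ (Ω₂ ⋈ Ω₃)`. -/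
theorem joinSet_comm_assoc
    (Ω₁ Ω₂ Ω₃ : Set (V → Option D)) :
    JoinSet Ω₁ Ω₂ = JoinSet Ω₂ Ω₁ ∧
    JoinSet (JoinSet Ω₁ Ω₂) Ω₃ = JoinSet Ω₁ (JoinSet Ω₂ Ω₃) :=
  ⟨joinSet_comm Ω₁ Ω₂, joinSet_assoc Ω₁ Ω₂ Ω₃⟩

end
end

section
/- The SPARQL left-outer-join is not associative: there exist types V and D and sets of SPARQL mappings Ω₁, Ω₂, Ω₃ : Set (V → Option D) such that (Ω₁ ⟕ Ω₂) ⟕ Ω₃ ≠ Ω₁ ⟕ (Ω₂ ⟕ Ω₃). A witness with V = Fin 2 and D = Fin 3: Ω₁ = {μ₁} with μ₁ 0 = some 1 and μ₁ 1 = none; Ω₂ = {μ₂} with μ₂ 0 = none and μ₂ 1 = some 1; Ω₃ = {μ₃} with μ₃ 0 = some 2 and μ₃ 1 = some 1; then (Ω₁ ⟕ Ω₂) ⟕ Ω₃ = {μ₁ ⊔ μ₂} while Ω₁ ⟕ (Ω₂ ⟕ Ω₃) = {μ₁}. -/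
/-- The mapping `μ₁` with `μ₁ 0 = some 1` and `μ₁ 1 = none`. -/
def μ₁ : Fin 2 → Option (Fin 3) := ![some 1, none]

/-- The mapping `μ₂` with `μ₂ 0 = none` and `μ₂ 1 = some 1`. -/
def μ₂ : Fin 2 → Option (Fin 3) := ![none, some 1]

/-- The mapping `μ₃` with `μ₃ 0 = some 2` and `μ₃ 1 = some 1`. -/
def μ₃ : Fin 2 → Option (Fin 3) := ![some 2, some 1]

theorem lojSet_singleton_of_compatible {V D : Type} {μ ν : V → Option D}
    (h : Compatible μ ν) : LojSet {μ} {ν} = {mUnion μ ν} := by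
  ext ω
  simp only [LojSet, JoinSet, DiffSet, Set.mem_union, Set.mem_ofPred_eq, Set.mem_singleton_iff,
    exists_eq_left, forall_eq]
  constructor
  · rintro (⟨-, rfl⟩ | ⟨rfl, hn⟩)
    · rfl
    · exact absurd h hn
  · exact fun hω => Or.inl ⟨h, hω⟩

theorem lojSet_singleton_of_not_compatible {V D : Type} {μ ν : V → Option D}
    (h : ¬ Compatible μ ν) : LojSet {μ} {ν} = {μ} := by
  ext ω
  simp only [LojSet, JoinSet, DiffSet, Set.mem_union, Set.mem_ofPred_eq, Set.mem_singleton_iff,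
    exists_eq_left, forall_eq]
  constructor
  · rintro (⟨hc, -⟩ | ⟨rfl, -⟩)
    · exact absurd hc h
    · rfl
  · rintro rfl
    exact Or.inr ⟨rfl, h⟩

theorem compatible_μ₁_μ₂ : Compatible μ₁ μ₂ := by
  simp [Compatible, dom, μ₁, μ₂, Fin.forall_fin_two]

theorem compatible_μ₂_μ₃ : Compatible μ₂ μ₃ := by
  simp [Compatible, dom, μ₂, μ₃, Fin.forall_fin_two]

theorem not_compatible_μ₁_μ₃ : ¬ Compatible μ₁ μ₃ := by
  simp [Compatible, dom, μ₁, μ₃, Fin.forall_fin_two]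

theorem mUnion_μ₂_μ₃ : mUnion μ₂ μ₃ = μ₃ := by
  decide

theorem not_compatible_mUnion_μ₁_μ₂_μ₃ : ¬ Compatible (mUnion μ₁ μ₂) μ₃ := by
  simp [Compatible, dom, mUnion, μ₁, μ₂, μ₃, Fin.forall_fin_two]

theorem mUnion_μ₁_μ₂_ne_μ₁ : mUnion μ₁ μ₂ ≠ μ₁ := by
  decide

/-- **The SPARQL left-outer-join is not associative.** There exist types `V`,
`D` and sets of SPARQL mappings `Ω₁, Ω₂, Ω₃` with
`(Ω₁ ⟕ Ω₂) ⟕ Ω₃ ≠ Ω₁ ⟕ (Ω₂ ⟕ Ω₃)`; the singletons `{μ₁}`, `{μ₂}`, `{μ₃}`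
over `V = Fin 2`, `D = Fin 3` witness this, with
`(Ω₁ ⟕ Ω₂) ⟕ Ω₃ = {μ₁ ⊔ μ₂}` while `Ω₁ ⟕ (Ω₂ ⟕ Ω₃) = {μ₁}`. -/
theorem loj_not_associative :
    (∃ (V D : Type) (Ω₁ Ω₂ Ω₃ : Set (V → Option D)),
      LojSet (LojSet Ω₁ Ω₂) Ω₃ ≠ LojSet Ω₁ (LojSet Ω₂ Ω₃)) ∧
    LojSet (LojSet {μ₁} {μ₂}) {μ₃} ≠ LojSet {μ₁} (LojSet {μ₂} {μ₃}) ∧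
    LojSet (LojSet {μ₁} {μ₂}) {μ₃} = {mUnion μ₁ μ₂} ∧
    LojSet {μ₁} (LojSet {μ₂} {μ₃}) = {μ₁} := by
  have hl : LojSet (LojSet {μ₁} {μ₂}) {μ₃} = {mUnion μ₁ μ₂} := by
    rw [lojSet_singleton_of_compatible compatible_μ₁_μ₂,
      lojSet_singleton_of_not_compatible not_compatible_mUnion_μ₁_μ₂_μ₃]
  have hr : LojSet {μ₁} (LojSet {μ₂} {μ₃}) = {μ₁} := by
    rw [lojSet_singleton_of_compatible compatible_μ₂_μ₃, mUnion_μ₂_μ₃,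
      lojSet_singleton_of_not_compatible not_compatible_μ₁_μ₃]
  have hne : LojSet (LojSet {μ₁} {μ₂}) {μ₃} ≠ LojSet {μ₁} (LojSet {μ₂} {μ₃}) := by
    rw [hl, hr]
    exact fun h => mUnion_μ₁_μ₂_ne_μ₁ (Set.singleton_injective h)
  exact ⟨⟨_, _, _, _, _, hne⟩, hne, hl, hr⟩
end
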